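/- arXiv:2305.14037 — 2 statements merged into one kernel-verified Lean document; each statement's English description precedes it below -/
import Mathlib

section
/- Let T ≥ 1, σ > 0, let f_0 be a probability density on ℝ, and let μ, ν be probability measures on ℝ with densities, finite second moments, and ∫ |log f_0| dμ < ∞. Let γ_T be the Gaussian random walk density γ_T(x_0,…,x_T) = f_0(x_0) ∏_{i=1}^T (2πσ²)^{−1/2} exp(−(x_i − x_{i−1})²/(2σ²)) on ℝ^{T+1}. If Q_1, Q_2 ∈ M_T(μ,ν) are both absolutely continuous with respect to Lebesgue measure with finite differential entropy, then H(Q_1 | γ_T·λ_{T+1}) − H(Q_2 | γ_T·λ_{T+1}) = H(Q_2) − H(Q_1); in particular, Q_1 maximizes differential entropy over M_T(μ,ν) if and only if it minimizes relative entropy with respect to the Gaussian random walk over M_T(μ,ν). -/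
open MeasureTheory Real

/-- `Q` is a martingale transport plan on `ℝ^{T+1}` between `μ` and `ν`: it is a probability
measure under which the coordinate process is a martingale in its natural filtration, with
`X_0 ∼ μ` and `X_T ∼ ν`. -/
def IsMartingaleTransportPlan (T : ℕ) (μ ν : Measure ℝ)
    (Q : Measure (Fin (T + 1) → ℝ)) : Prop :=
  IsProbabilityMeasure Q ∧
  Martingale (fun (i : Fin (T + 1)) (ω : Fin (T + 1) → ℝ) => ω i)
    (Filtration.natural (fun (i : Fin (T + 1)) (ω : Fin (T + 1) → ℝ) => ω i)
      (fun i => (measurable_pi_apply i).stronglyMeasurable)) Q ∧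
  Q.map (fun ω => ω 0) = μ ∧ Q.map (fun ω => ω (Fin.last T)) = ν

/-- `Q` has density `q` with respect to Lebesgue measure on `ℝ^{T+1}` and finite
differential entropy. -/
def HasDensityWithFiniteEntropy (T : ℕ) (Q : Measure (Fin (T + 1) → ℝ))
    (q : (Fin (T + 1) → ℝ) → ℝ) : Prop :=
  (∀ ω, 0 ≤ q ω) ∧ Measurable q ∧
  Q = (volume : Measure (Fin (T + 1) → ℝ)).withDensity (fun ω => ENNReal.ofReal (q ω)) ∧
  Integrable (fun ω => q ω * Real.log (q ω)) (volume : Measure (Fin (T + 1) → ℝ))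

/-- The density `γ_T` on `ℝ^{T+1}` of the Gaussian random walk with step variance `σ²`,
started from the density `f₀`. -/
noncomputable def gaussianRW (T : ℕ) (σ : ℝ) (f₀ : ℝ → ℝ) (ω : Fin (T + 1) → ℝ) : ℝ :=
  f₀ (ω 0) * ∏ i : Fin T,
    (Real.sqrt (2 * π * σ ^ 2))⁻¹ * Real.exp (-(ω i.succ - ω i.castSucc) ^ 2 / (2 * σ ^ 2))

/-- A martingale increment of square-integrable variables has second moment equal to the
increment of the second moments. -/
theorem MeasureTheory.Martingale.integral_sub_sq {Ω ι : Type*} [Preorder ι] {m0 : MeasurableSpace Ω}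
    {P : Measure Ω} [IsFiniteMeasure P] {ℱ : Filtration ι m0} {X : ι → Ω → ℝ}
    (hX : Martingale X ℱ P) (h2 : ∀ i, MemLp (X i) 2 P) {i j : ι} (hij : i ≤ j) :
    ∫ ω, (X j ω - X i ω) ^ 2 ∂P = (∫ ω, X j ω ^ 2 ∂P) - ∫ ω, X i ω ^ 2 ∂P := by
  have hcross : ∫ ω, X i ω * X j ω ∂P = ∫ ω, X i ω ^ 2 ∂P := by
    have hpull : P[X i * X j | ℱ i] =ᵐ[P] X i * P[X j | ℱ i] :=
      condExp_mul_of_stronglyMeasurable_left (hX.stronglyMeasurable i)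
        ((h2 i).integrable_mul (h2 j)) (hX.integrable j)
    have hcond := integral_condExp (μ := P) (f := X i * X j) (ℱ.le i)
    simp only [Pi.mul_apply] at hcond
    rw [← hcond]
    refine integral_congr_ae ?_
    filter_upwards [hpull, hX.condExp_ae_eq hij] with ω h₁ h₂
    rw [h₁, Pi.mul_apply, h₂, sq]
  have hc : Integrable (fun ω => X i ω * X j ω) P := (h2 i).integrable_mul (h2 j)
  have hi := (h2 i).integrable_sq
  have hj := (h2 j).integrable_sq
  have hd : Integrable (fun ω => X j ω ^ 2 - 2 * (X i ω * X j ω)) P := hj.sub (hc.const_mul 2)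
  calc ∫ ω, (X j ω - X i ω) ^ 2 ∂P
      = ∫ ω, (X j ω ^ 2 - 2 * (X i ω * X j ω) + X i ω ^ 2) ∂P := by
        congr 1 with ω; ring
    _ = (∫ ω, X j ω ^ 2 ∂P) - ∫ ω, X i ω ^ 2 ∂P := by
        rw [integral_add hd hi, integral_sub hj (hc.const_mul 2),
          integral_const_mul, hcross]
        ring

/-- Every time marginal of a martingale with square-integrable terminal value is
square-integrable. -/
theorem MeasureTheory.Martingale.memLp_two_of_le {Ω ι : Type*} [Preorder ι] {m0 : MeasurableSpace Ω}
    {P : Measure Ω} {ℱ : Filtration ι m0} {X : ι → Ω → ℝ}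
    (hX : Martingale X ℱ P) {i j : ι} (hij : i ≤ j) (hj : MemLp (X j) 2 P) : MemLp (X i) 2 P :=
  (memLp_congr_ae (hX.condExp_ae_eq hij)).1 (hj.condExp one_le_two)

theorem Fin.sum_univ_succ_sub_castSucc {M : Type*} [AddCommGroup M] :
    ∀ {n : ℕ} (a : Fin (n + 1) → M),
      ∑ i : Fin n, (a i.succ - a i.castSucc) = a (Fin.last n) - a 0
  | 0, a => by simp
  | n + 1, a => by
    have h := Fin.sum_univ_succ_sub_castSucc (fun i : Fin (n + 1) => a i.castSucc)
    simp only [← Fin.succ_castSucc, Fin.castSucc_zero] at h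
    rw [Fin.sum_univ_castSucc, h, Fin.succ_last]
    abel

theorem log_gaussianRW (T : ℕ) {σ : ℝ} (hσ : 0 < σ) (f₀ : ℝ → ℝ) (ω : Fin (T + 1) → ℝ)
    (h : 0 < f₀ (ω 0)) :
    Real.log (gaussianRW T σ f₀ ω) = Real.log (f₀ (ω 0)) +
      ∑ i : Fin T, (Real.log (Real.sqrt (2 * π * σ ^ 2))⁻¹
        - (ω i.succ - ω i.castSucc) ^ 2 / (2 * σ ^ 2)) := by
  have hc : 0 < (Real.sqrt (2 * π * σ ^ 2))⁻¹ := by positivity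
  rw [gaussianRW, Real.log_mul h.ne' (Finset.prod_pos fun i _ => by positivity).ne',
    Real.log_prod fun i _ => by positivity]
  congr 1
  refine Finset.sum_congr rfl fun i _ => ?_
  rw [Real.log_mul hc.ne' (Real.exp_pos _).ne', Real.log_exp]
  ring

theorem gaussianRW_pos (T : ℕ) {σ : ℝ} (hσ : 0 < σ) (f₀ : ℝ → ℝ) (ω : Fin (T + 1) → ℝ)
    (h : 0 < f₀ (ω 0)) : 0 < gaussianRW T σ f₀ ω :=
  mul_pos h (Finset.prod_pos fun i _ => by positivity)

/-- The log-density of the Gaussian random walk has the same integral under every martingale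
transport plan between `μ` and `ν`. -/
theorem IsMartingaleTransportPlan.integral_log_gaussianRW {T : ℕ} {σ : ℝ} (hσ : 0 < σ)
    {f₀ : ℝ → ℝ} {μ ν : Measure ℝ}
    (hμ2 : Integrable (fun x : ℝ => x ^ 2) μ) (hν2 : Integrable (fun x : ℝ => x ^ 2) ν)
    (hf₀pos : ∀ᵐ x ∂μ, 0 < f₀ x) (hlogf₀ : Integrable (fun x => Real.log (f₀ x)) μ)
    {Q : Measure (Fin (T + 1) → ℝ)} (hQ : IsMartingaleTransportPlan T μ ν Q) :
    Integrable (fun ω => Real.log (gaussianRW T σ f₀ ω)) Q ∧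
      ∫ ω, Real.log (gaussianRW T σ f₀ ω) ∂Q =
        (∫ x, Real.log (f₀ x) ∂μ) + (T * Real.log (Real.sqrt (2 * π * σ ^ 2))⁻¹
          - ((∫ x, x ^ 2 ∂ν) - ∫ x, x ^ 2 ∂μ) / (2 * σ ^ 2)) := by
  obtain ⟨hP, hM, h0, hT⟩ := hQ
  have hm : ∀ i, AEMeasurable (fun ω : Fin (T + 1) → ℝ => ω i) Q :=
    fun i => (measurable_pi_apply i).aemeasurable
  have hlast : MemLp (fun ω : Fin (T + 1) → ℝ => ω (Fin.last T)) 2 Q := by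
    rw [memLp_two_iff_integrable_sq (hm _).aestronglyMeasurable]
    rw [← hT] at hν2
    exact hν2.comp_aemeasurable (hm _)
  have h2 : ∀ i, MemLp (fun ω : Fin (T + 1) → ℝ => ω i) 2 Q :=
    fun i => hM.memLp_two_of_le (Fin.le_last i) hlast
  have hpos : ∀ᵐ ω ∂Q, 0 < f₀ (ω 0) := by
    rw [← h0] at hf₀pos
    exact ae_of_ae_map (hm 0) hf₀pos
  have hlog : Integrable (fun ω : Fin (T + 1) → ℝ => Real.log (f₀ (ω 0))) Q := by
    rw [← h0] at hlogf₀
    exact hlogf₀.comp_aemeasurable (hm 0)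
  have hlogeq : ∫ ω, Real.log (f₀ (ω 0)) ∂Q = ∫ x, Real.log (f₀ x) ∂μ := by
    subst h0
    rw [integral_map (hm 0) hlogf₀.aestronglyMeasurable]
  have hsq0 : ∫ ω, (ω 0) ^ 2 ∂Q = ∫ x, x ^ 2 ∂μ := by
    subst h0
    rw [integral_map (hm 0) hμ2.aestronglyMeasurable]
  have hsqT : ∫ ω, (ω (Fin.last T)) ^ 2 ∂Q = ∫ x, x ^ 2 ∂ν := by
    subst hT
    rw [integral_map (hm _) hν2.aestronglyMeasurable]
  set c := Real.log (Real.sqrt (2 * π * σ ^ 2))⁻¹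
  have hincr : ∀ i : Fin T, Integrable
      (fun ω : Fin (T + 1) → ℝ => (ω i.succ - ω i.castSucc) ^ 2 / (2 * σ ^ 2)) Q :=
    fun i => ((h2 i.succ).sub (h2 i.castSucc)).integrable_sq.div_const _
  have hterm : ∀ i : Fin T, Integrable
      (fun ω : Fin (T + 1) → ℝ => c - (ω i.succ - ω i.castSucc) ^ 2 / (2 * σ ^ 2)) Q :=
    fun i => (integrable_const c).sub (hincr i)
  have hsum : Integrable (fun ω : Fin (T + 1) → ℝ =>
      ∑ i : Fin T, (c - (ω i.succ - ω i.castSucc) ^ 2 / (2 * σ ^ 2))) Q :=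
    integrable_finsetSum _ fun i _ => hterm i
  have hae : (fun ω => Real.log (gaussianRW T σ f₀ ω)) =ᵐ[Q] fun ω => Real.log (f₀ (ω 0)) +
      ∑ i : Fin T, (c - (ω i.succ - ω i.castSucc) ^ 2 / (2 * σ ^ 2)) := by
    filter_upwards [hpos] with ω h using log_gaussianRW T hσ f₀ ω h
  refine ⟨(hlog.add hsum).congr hae.symm, ?_⟩
  rw [integral_congr_ae hae, integral_add hlog hsum, hlogeq,
    integral_finsetSum _ fun i _ => hterm i]
  congr 1
  have hi : ∀ i : Fin T,
      ∫ ω : Fin (T + 1) → ℝ, (c - (ω i.succ - ω i.castSucc) ^ 2 / (2 * σ ^ 2)) ∂Q =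
        c - ((∫ ω, (ω i.succ) ^ 2 ∂Q) - ∫ ω, (ω i.castSucc) ^ 2 ∂Q) / (2 * σ ^ 2) := by
    intro i
    rw [integral_sub (integrable_const c) (hincr i), integral_div,
      hM.integral_sub_sq h2 i.castSucc_lt_succ.le]
    simp
  simp_rw [hi]
  rw [Finset.sum_sub_distrib, ← Finset.sum_div,
    Fin.sum_univ_succ_sub_castSucc (fun i => ∫ ω : Fin (T + 1) → ℝ, (ω i) ^ 2 ∂Q), hsq0, hsqT]
  simp

/-- The relative entropy of a plan with density `q` with respect to a measure with density `γ`,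
split into its differential entropy and the integral of `log γ`. -/
theorem HasDensityWithFiniteEntropy.integral_log_div {T : ℕ} {Q : Measure (Fin (T + 1) → ℝ)}
    {q γ : (Fin (T + 1) → ℝ) → ℝ} (hq : HasDensityWithFiniteEntropy T Q q)
    (hγ : ∀ᵐ ω ∂Q, 0 < γ ω) (hγi : Integrable (fun ω => Real.log (γ ω)) Q) :
    ∫ ω, Real.log (q ω / γ ω) ∂Q = (∫ ω, q ω * Real.log (q ω)) - ∫ ω, Real.log (γ ω) ∂Q := by
  obtain ⟨hnn, hqm, rfl, hqi⟩ := hq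
  have hmeas : Measurable fun ω => ENNReal.ofReal (q ω) := hqm.ennreal_ofReal
  have hfin : ∀ᵐ ω : Fin (T + 1) → ℝ, ENNReal.ofReal (q ω) < ⊤ :=
    ae_of_all _ fun _ => ENNReal.ofReal_lt_top
  have hpos : ∀ᵐ ω ∂(volume : Measure (Fin (T + 1) → ℝ)).withDensity
      (fun ω => ENNReal.ofReal (q ω)), 0 < q ω := by
    rw [ae_withDensity_iff hmeas]
    exact ae_of_all _ fun ω h => by simpa using h
  have hlog : Integrable (fun ω => Real.log (q ω)) ((volume : Measure (Fin (T + 1) → ℝ)).withDensity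
      (fun ω => ENNReal.ofReal (q ω))) := by
    rw [integrable_withDensity_iff_integrable_smul' hmeas hfin]
    simpa [ENNReal.toReal_ofReal, hnn] using hqi
  have heq : ∫ ω, Real.log (q ω) ∂(volume : Measure (Fin (T + 1) → ℝ)).withDensity
      (fun ω => ENNReal.ofReal (q ω)) = ∫ ω, q ω * Real.log (q ω) := by
    rw [integral_withDensity_eq_integral_toReal_smul hmeas hfin]
    simp [ENNReal.toReal_ofReal, hnn]
  rw [← heq, ← integral_sub hlog hγi]
  refine integral_congr_ae ?_
  filter_upwards [hpos, hγ] with ω h₁ h₂ using Real.log_div h₁.ne' h₂.ne'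

/-- for martingale transport plans `Q₁ = q₁·λ`, `Q₂ = q₂·λ` with finite
differential entropy,
`H(Q₁|γ_T·λ) − H(Q₂|γ_T·λ) = H(Q₂) − H(Q₁)` (relative entropies computed via densities as
`∫ log(qᵢ/γ_T) dQᵢ`, and `H(Q) = −∫ q log q dλ`); in particular `Q₁` maximizes differential
entropy over martingale transport plans if and only if it minimizes relative entropy with
respect to the Gaussian random walk over martingale transport plans. -/
theorem entropy_max_iff_relative_entropy_min (T : ℕ) (hT : 1 ≤ T) (σ : ℝ) (hσ : 0 < σ)
    (f₀ : ℝ → ℝ) (hf₀m : Measurable f₀) (hf₀nn : ∀ x, 0 ≤ f₀ x)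
    (hf₀i : (∫ x, f₀ x) = 1)
    (μ ν : Measure ℝ) [IsProbabilityMeasure μ] [IsProbabilityMeasure ν]
    (hμac : μ ≪ (volume : Measure ℝ)) (hνac : ν ≪ (volume : Measure ℝ))
    (hμ2 : Integrable (fun x : ℝ => x ^ 2) μ) (hν2 : Integrable (fun x : ℝ => x ^ 2) ν)
    (hf₀pos : ∀ᵐ x ∂μ, 0 < f₀ x)
    (hlogf₀ : Integrable (fun x => Real.log (f₀ x)) μ)
    (Q₁ Q₂ : Measure (Fin (T + 1) → ℝ)) (q₁ q₂ : (Fin (T + 1) → ℝ) → ℝ)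
    (hQ₁ : IsMartingaleTransportPlan T μ ν Q₁) (hQ₂ : IsMartingaleTransportPlan T μ ν Q₂)
    (hq₁ : HasDensityWithFiniteEntropy T Q₁ q₁) (hq₂ : HasDensityWithFiniteEntropy T Q₂ q₂) :
    ((∫ ω, Real.log (q₁ ω / gaussianRW T σ f₀ ω) ∂Q₁)
        - (∫ ω, Real.log (q₂ ω / gaussianRW T σ f₀ ω) ∂Q₂)
      = (-(∫ ω, q₂ ω * Real.log (q₂ ω))) - (-(∫ ω, q₁ ω * Real.log (q₁ ω))))
    ∧ ((∀ Q q, IsMartingaleTransportPlan T μ ν Q → HasDensityWithFiniteEntropy T Q q →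
          -(∫ ω, q ω * Real.log (q ω)) ≤ -(∫ ω, q₁ ω * Real.log (q₁ ω)))
        ↔ (∀ Q q, IsMartingaleTransportPlan T μ ν Q → HasDensityWithFiniteEntropy T Q q →
          (∫ ω, Real.log (q₁ ω / gaussianRW T σ f₀ ω) ∂Q₁)
            ≤ ∫ ω, Real.log (q ω / gaussianRW T σ f₀ ω) ∂Q)) := by
  have key : ∀ Q q, IsMartingaleTransportPlan T μ ν Q → HasDensityWithFiniteEntropy T Q q →
      ∫ ω, Real.log (q ω / gaussianRW T σ f₀ ω) ∂Q = (∫ ω, q ω * Real.log (q ω)) -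
        ((∫ x, Real.log (f₀ x) ∂μ) + (T * Real.log (Real.sqrt (2 * π * σ ^ 2))⁻¹
          - ((∫ x, x ^ 2 ∂ν) - ∫ x, x ^ 2 ∂μ) / (2 * σ ^ 2))) := by
    intro Q q hQ hq
    obtain ⟨hi, he⟩ := hQ.integral_log_gaussianRW hσ hμ2 hν2 hf₀pos hlogf₀
    have hpos : ∀ᵐ ω ∂Q, 0 < gaussianRW T σ f₀ ω := by
      rw [← hQ.2.2.1] at hf₀pos
      filter_upwards [ae_of_ae_map (measurable_pi_apply 0).aemeasurable hf₀pos] with ω h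
        using gaussianRW_pos T hσ f₀ ω h
    rw [hq.integral_log_div hpos hi, he]
  refine ⟨?_, forall₄_congr fun Q q hQ hq => ?_⟩
  · rw [key Q₁ q₁ hQ₁ hq₁, key Q₂ q₂ hQ₂ hq₂]
    ring
  · rw [key Q₁ q₁ hQ₁ hq₁, key Q q hQ hq, neg_le_neg_iff, sub_le_sub_iff_right]
end

section
/- Define v̄(s,x) = (x − x² − 1 + s)/2 − (1−s)·log( sin(πx)/(π√(1−s)) ) for s ∈ [0,1), x ∈ (0,1). Then for every (t,x) ∈ (0,1) × (0,1) and every Σ ∈ (0,∞), ∂_t v̄(t,x) + (1/2)·{ Σ·∂²_{xx} v̄(t,x) + Σ − log Σ − 1 } ≥ 0, with equality if and only if Σ = sin²(πx)/(π²(1−t)). -/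
open Real

/-- The value function of the Aldous martingale:
`v̄(s,x) = (x − x² − 1 + s)/2 − (1−s) log(sin(πx)/(π√(1−s)))`. -/
noncomputable def vbar (s x : ℝ) : ℝ :=
  (x - x ^ 2 - 1 + s) / 2 - (1 - s) * Real.log (Real.sin (π * x) / (π * Real.sqrt (1 - s)))

theorem sin_pi_mul_pos {x : ℝ} (hx : x ∈ Set.Ioo (0 : ℝ) 1) : 0 < sin (π * x) :=
  sin_pos_of_pos_of_lt_pi (mul_pos pi_pos hx.1) (by nlinarith [pi_pos, hx.2])

theorem hasDerivAt_vbar_time {t x : ℝ} (ht : t < 1) (hx : x ∈ Set.Ioo (0 : ℝ) 1) :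
    HasDerivAt (fun s : ℝ => vbar s x) (log (sin (π * x) / (π * √(1 - t)))) t := by
  have h1 : 0 < 1 - t := sub_pos.2 ht
  have hs := sin_pi_mul_pos hx
  have hsqrt : 0 < √(1 - t) := sqrt_pos.2 h1
  have hlin : HasDerivAt (fun s : ℝ => 1 - s) (-1) t := (hasDerivAt_id t).const_sub 1
  have hden : HasDerivAt (fun s : ℝ => π * √(1 - s)) (π * (-1 / (2 * √(1 - t)))) t :=
    (hlin.sqrt h1.ne').const_mul π
  have hlog := ((hasDerivAt_const t (sin (π * x))).fun_div hden (by positivity)).log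
    (by positivity)
  have hpoly : HasDerivAt (fun s : ℝ => (x - x ^ 2 - 1 + s) / 2) (1 / 2) t :=
    ((hasDerivAt_id t).const_add (x - x ^ 2 - 1)).div_const 2
  refine (hpoly.fun_sub (hlin.fun_mul hlog)).congr_deriv ?_
  have hsq : √(1 - t) ^ 2 = 1 - t := sq_sqrt h1.le
  generalize log (sin (π * x) / (π * √(1 - t))) = L
  generalize √(1 - t) = r at hsq hsqrt ⊢
  rw [← hsq]
  field_simp
  ring

theorem hasDerivAt_vbar_space {t x : ℝ} (ht : t < 1) (hx : x ∈ Set.Ioo (0 : ℝ) 1) :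
    HasDerivAt (vbar t) ((1 - 2 * x) / 2 - (1 - t) * (π * (cos (π * x) / sin (π * x)))) x := by
  have hs := sin_pi_mul_pos hx
  have hsqrt : 0 < √(1 - t) := sqrt_pos.2 (sub_pos.2 ht)
  have hlin : HasDerivAt (fun y : ℝ => π * y) π x := by
    simpa using (hasDerivAt_id x).const_mul π
  have hlog := (hlin.sin.div_const (π * √(1 - t))).log (by positivity)
  have hpoly : HasDerivAt (fun y : ℝ => (y - y ^ 2 - 1 + t) / 2) ((1 - 2 * x) / 2) x := by
    simpa using ((((hasDerivAt_id x).sub (hasDerivAt_pow 2 x)).sub_const 1).add_const t).div_const 2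
  refine (hpoly.fun_sub (hlog.const_mul (1 - t))).congr_deriv ?_
  field_simp

theorem deriv_deriv_vbar_space {t x : ℝ} (ht : t < 1) (hx : x ∈ Set.Ioo (0 : ℝ) 1) :
    deriv (deriv (vbar t)) x = π ^ 2 * (1 - t) / sin (π * x) ^ 2 - 1 := by
  have hs := sin_pi_mul_pos hx
  have hlin : HasDerivAt (fun y : ℝ => π * y) π x := by
    simpa using (hasDerivAt_id x).const_mul π
  have hpoly : HasDerivAt (fun y : ℝ => (1 - 2 * y) / 2) (-1) x := by
    simpa using (((hasDerivAt_id x).const_mul 2).const_sub 1).div_const 2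
  have hcot := ((hlin.cos.fun_div hlin.sin hs.ne').const_mul π).const_mul (1 - t)
  have heq : deriv (vbar t) =ᶠ[nhds x]
      fun y => (1 - 2 * y) / 2 - (1 - t) * (π * (cos (π * y) / sin (π * y))) := by
    filter_upwards [Ioo_mem_nhds hx.1 hx.2] with y hy
    exact (hasDerivAt_vbar_space ht hy).deriv
  rw [heq.deriv_eq, (hpoly.fun_sub hcot).deriv]
  field_simp
  linear_combination (1 - t) * π ^ 2 * sin_sq_add_cos_sq (π * x)

theorem log_sin_div_pi_mul_sqrt {t : ℝ} (x : ℝ) (ht : t < 1) :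
    log (sin (π * x) / (π * √(1 - t))) = log (sin (π * x) ^ 2 / (π ^ 2 * (1 - t))) / 2 := by
  have h : sin (π * x) ^ 2 / (π ^ 2 * (1 - t)) = (sin (π * x) / (π * √(1 - t))) ^ 2 := by
    rw [div_pow, mul_pow, sq_sqrt (sub_pos.2 ht).le]
  rw [h, log_pow]
  push_cast
  ring

theorem sub_one_sub_log_eq_zero_iff {u : ℝ} (hu : 0 < u) : u - 1 - log u = 0 ↔ u = 1 := by
  refine ⟨fun h => ?_, fun h => by simp [h]⟩
  by_contra hne
  linarith [log_lt_sub_one_of_pos hu hne]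

/-- for every `(t,x) ∈ (0,1)²` and `Σ ∈ (0,∞)`,
`∂ₜ v̄(t,x) + (1/2){Σ ∂²ₓₓ v̄(t,x) + Σ − log Σ − 1} ≥ 0`, with equality iff
`Σ = sin²(πx)/(π²(1−t))`. -/
theorem verification_inequality (t x : ℝ) (ht : t ∈ Set.Ioo (0 : ℝ) 1)
    (hx : x ∈ Set.Ioo (0 : ℝ) 1) (S : ℝ) (hS : S ∈ Set.Ioi (0 : ℝ)) :
    0 ≤ deriv (fun s : ℝ => vbar s x) t
        + (1 / 2) * (S * deriv (deriv (vbar t)) x + S - Real.log S - 1)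
    ∧ (deriv (fun s : ℝ => vbar s x) t
        + (1 / 2) * (S * deriv (deriv (vbar t)) x + S - Real.log S - 1) = 0
      ↔ S = Real.sin (π * x) ^ 2 / (π ^ 2 * (1 - t))) := by
  have hs := sin_pi_mul_pos hx
  have h1 : 0 < 1 - t := sub_pos.2 ht.2
  have hS' : 0 < S := hS
  rw [(hasDerivAt_vbar_time ht.2 hx).deriv, deriv_deriv_vbar_space ht.2 hx,
    log_sin_div_pi_mul_sqrt x ht.2]
  set v := sin (π * x) ^ 2 / (π ^ 2 * (1 - t)) with hv
  have hvpos : 0 < v := by positivity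
  have hinv : π ^ 2 * (1 - t) / sin (π * x) ^ 2 = v⁻¹ := by rw [hv, inv_div]
  have hu : 0 < S / v := div_pos hS' hvpos
  have key : log v / 2 + 1 / 2 * (S * (π ^ 2 * (1 - t) / sin (π * x) ^ 2 - 1) + S - log S - 1)
      = 1 / 2 * (S / v - 1 - log (S / v)) := by
    rw [hinv, log_div hS'.ne' hvpos.ne']
    ring
  rw [key]
  constructor
  · linarith [log_le_sub_one_of_pos hu]
  · rw [mul_eq_zero_iff_left (by norm_num), sub_one_sub_log_eq_zero_iff hu,
      div_eq_one_iff_eq hvpos.ne']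
end
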